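/- arXiv:1412.3309 — 3 statements merged into one kernel-verified Lean document; each statement's English description precedes it below -/
import Mathlib

section
/- Let x be a monomial of degree n in P_k, where μ(n) ≤ k, and let z be a minimal spike of degree n in P_k. If ω(x) < ω(z) in the left lexicographic order, then x is hit. -/
/-- `μ(n)`: the smallest `r` such that `n` can be written as a sum of `r` numbers
of the form `2^d - 1` with `d > 0`. -/
noncomputable def muNat (n : ℕ) : ℕ :=
  sInf {r : ℕ | ∃ d : Fin r → ℕ, (∀ i, 0 < d i) ∧ n = ∑ i, (2 ^ d i - 1)}

open MvPolynomial

/-- The total Steenrod square on `P_k = F_2[x_1,…,x_k]`, the algebra map with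
`Sq(x_j) = x_j + x_j^2`. -/
noncomputable def SqTotal (k : ℕ) :
    MvPolynomial (Fin k) (ZMod 2) →ₐ[ZMod 2] MvPolynomial (Fin k) (ZMod 2) :=
  aeval fun j => X j + X j ^ 2

/-- The Steenrod square `Sq^i : P_k → P_k`, sending a homogeneous polynomial `f` of
degree `d` to the degree-`d + i` homogeneous component of `Sq(f)`, extended additively. -/
noncomputable def SqOp (k i : ℕ) (f : MvPolynomial (Fin k) (ZMod 2)) :
    MvPolynomial (Fin k) (ZMod 2) :=
  ∑ d ∈ Finset.range (f.totalDegree + 1),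
    homogeneousComponent (d + i) (SqTotal k (homogeneousComponent d f))

/-- The space of hit polynomials: finite sums of `Sq^i (f_i)` with `i > 0`. -/
noncomputable def hitSubmodule (k : ℕ) :
    Submodule (ZMod 2) (MvPolynomial (Fin k) (ZMod 2)) :=
  Submodule.span (ZMod 2) {g | ∃ i f, 0 < i ∧ g = SqOp k i f}

/-- A polynomial is hit if it is a finite sum of `Sq^i (f_i)` with `i > 0`. -/
def IsHit (k : ℕ) (f : MvPolynomial (Fin k) (ZMod 2)) : Prop := f ∈ hitSubmodule k

/-- `(QP_k)_n`: the space of homogeneous polynomials of degree `n` modulo hit polynomials. -/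
abbrev QP (k n : ℕ) :=
  ↥(homogeneousSubmodule (Fin k) (ZMod 2) n) ⧸
    ((hitSubmodule k).comap (homogeneousSubmodule (Fin k) (ZMod 2) n).subtype)

/-- `ω_{i+1}(x)` for the monomial with exponent vector `a`: the number of variables whose
exponent has `i`-th binary digit equal to `1`. -/
def wvec (k : ℕ) (a : Fin k →₀ ℕ) (i : ℕ) : ℕ :=
  (Finset.univ.filter fun j : Fin k => Nat.testBit (a j) i).card

/-- Left lexicographic strict order on weight vectors. -/
def wlt (u v : ℕ → ℕ) : Prop := ∃ i, (∀ j, j < i → u j = v j) ∧ u i < v i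

/-- A minimal spike, described by its exponent vector `b`: there are `r` and exponents
`s_j` with `b_j = 2^{s_j} - 1`, `s_1 > … > s_{r-1} ≥ s_r > 0` and `s_j = 0` for `j > r`. -/
def IsMinimalSpike (k : ℕ) (b : Fin k →₀ ℕ) : Prop :=
  ∃ (r : ℕ) (s : Fin k → ℕ),
    (∀ j, b j = 2 ^ s j - 1) ∧
    (∀ i j : Fin k, i < j → (j : ℕ) + 1 < r → s j < s i) ∧
    (∀ i j : Fin k, i < j → (j : ℕ) < r → s j ≤ s i) ∧
    (∀ j : Fin k, (j : ℕ) < r → 0 < s j) ∧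
    (∀ j : Fin k, r ≤ (j : ℕ) → s j = 0)

theorem length_bitIndices_add_one_le (n : ℕ) :
    (n + 1).bitIndices.length ≤ n.bitIndices.length + 1 := by
  induction n using Nat.strong_induction_on with
  | _ n ih =>
    obtain ⟨m, rfl | rfl⟩ := n.even_or_odd'
    · simp
    · have h := ih m (by omega)
      rw [show 2 * m + 1 + 1 = 2 * (m + 1) by ring]
      simp only [Nat.bitIndices_two_mul, Nat.bitIndices_two_mul_add_one, List.length_map,
        List.length_cons]
      omega

theorem length_bitIndices_add_two_pow_le (a n : ℕ) :
    (n + 2 ^ a).bitIndices.length ≤ n.bitIndices.length + 1 := by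
  induction a generalizing n with
  | zero => exact length_bitIndices_add_one_le n
  | succ a ih =>
    obtain ⟨m, rfl | rfl⟩ := n.even_or_odd'
    · rw [show 2 * m + 2 ^ (a + 1) = 2 * (m + 2 ^ a) by ring]
      simpa using ih m
    · rw [show 2 * m + 1 + 2 ^ (a + 1) = 2 * (m + 2 ^ a) + 1 by ring]
      simpa using ih m

theorem length_bitIndices_sum_two_pow_le {ι : Type*} (J : Finset ι) (f : ι → ℕ) :
    (∑ j ∈ J, 2 ^ f j).bitIndices.length ≤ J.card := by
  classical
  induction J using Finset.induction_on with
  | empty => simp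
  | insert j J hj ih =>
    rw [Finset.sum_insert hj, Finset.card_insert_of_notMem hj, add_comm]
    exact (length_bitIndices_add_two_pow_le _ _).trans (by omega)

theorem length_bitIndices_finset_sum (S : Finset ℕ) :
    (∑ i ∈ S, 2 ^ i).bitIndices.length = S.card := by
  rw [← List.toFinset_card_of_nodup Nat.bitIndices_nodup,
    Finset.toFinset_bitIndices_sum_two_pow]

theorem sum_two_pow_sub_one_add_card {ι : Type*} (J : Finset ι) (σ : ι → ℕ) :
    ∑ j ∈ J, (2 ^ σ j - 1) + J.card = ∑ j ∈ J, 2 ^ σ j := by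
  rw [Finset.card_eq_sum_ones, ← Finset.sum_add_distrib]
  exact Finset.sum_congr rfl fun j _ => Nat.sub_add_cancel Nat.one_le_two_pow

/-- A minimal spike has the least possible number of nonzero exponents in its degree. -/
theorem card_le_of_sum_two_pow_sub_one_eq {ι κ : Type*} [DecidableEq ι] {J : Finset ι} {l : ι}
    (hl : l ∈ J) {σ : ι → ℕ} (hinj : Set.InjOn σ (J.erase l))
    (hle : ∀ j ∈ J.erase l, σ l ≤ σ j) (hpos : 0 < σ l) (E : Finset κ) (u : κ → ℕ)
    (h : ∑ j ∈ J, (2 ^ σ j - 1) = ∑ i ∈ E, (2 ^ u i - 1)) : J.card ≤ E.card := by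
  by_contra! hlt
  set S : Finset ℕ := (J.erase l).image σ with hS
  have hdisj : Disjoint S (Finset.range (σ l)) := by
    rw [Finset.disjoint_left]
    intro x hx hx'
    obtain ⟨j, hj, rfl⟩ := Finset.mem_image.1 hx
    exact absurd (Finset.mem_range.1 hx') (not_lt.2 (hle j hj))
  have hcard : (S ∪ Finset.range (σ l)).card = J.card - 1 + σ l := by
    rw [Finset.card_union_of_disjoint hdisj, hS, Finset.card_image_of_injOn hinj,
      Finset.card_erase_of_mem hl, Finset.card_range]
  have hsum : ∑ i ∈ S ∪ Finset.range (σ l), 2 ^ i + 1 = ∑ j ∈ J, 2 ^ σ j := by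
    rw [Finset.sum_union hdisj, hS, Finset.sum_image hinj, Nat.geomSum_eq le_rfl,
      ← Finset.sum_erase_add J _ hl]
    have := @Nat.one_le_two_pow (σ l)
    simp only [Nat.add_one_sub_one, Nat.div_one]
    omega
  have hE := sum_two_pow_sub_one_add_card E u
  have hJ := sum_two_pow_sub_one_add_card J σ
  have hrw : ∑ i ∈ S ∪ Finset.range (σ l), 2 ^ i =
      ∑ i ∈ E.disjSum (Finset.range (J.card - 1 - E.card)), 2 ^ (Sum.elim u (fun _ => 0) i) := by
    simp only [Finset.sum_disjSum, Sum.elim_inl, Sum.elim_inr, pow_zero, Finset.sum_const,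
      Finset.card_range, smul_eq_mul, mul_one]
    omega
  have h1 := length_bitIndices_finset_sum (S ∪ Finset.range (σ l))
  rw [hrw] at h1
  have h2 := length_bitIndices_sum_two_pow_le
    (E.disjSum (Finset.range (J.card - 1 - E.card))) (Sum.elim u (fun _ => 0))
  rw [h1, hcard, Finset.card_disjSum, Finset.card_range] at h2
  omega

theorem testBit_of_odd_choose {c p : ℕ} (h : ((c.choose p : ℕ) : ZMod 2) ≠ 0) {q : ℕ}
    (hq : p.testBit q) : c.testBit q := by
  induction q generalizing c p with
  | zero =>
    have hL := (ZMod.natCast_eq_natCast_iff _ _ 2).2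
      (@Choose.choose_modEq_choose_mod_mul_choose_div_nat c p 2 _)
    rw [hL] at h
    simp only [Nat.testBit_zero, decide_eq_true_eq] at hq ⊢
    by_contra hc
    rw [hq, show c % 2 = 0 by omega] at h
    simp at h
  | succ q ih =>
    have hL := (ZMod.natCast_eq_natCast_iff _ _ 2).2
      (@Choose.choose_modEq_choose_mod_mul_choose_div_nat c p 2 _)
    rw [hL, Nat.cast_mul] at h
    rw [Nat.testBit_add_one] at hq ⊢
    exact ih (right_ne_zero_of_mul h) hq

section

variable {k : ℕ}

theorem SqTotal_monomial (c : Fin k →₀ ℕ) :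
    SqTotal k (monomial c 1) =
      ∑ p ∈ Fintype.piFinset fun j => Finset.range (c j + 1),
        monomial (c + Finsupp.equivFunOnFinite.symm p) (∏ j, ((c j).choose (p j) : ZMod 2)) := by
  have hX : ∀ j : Fin k, SqTotal k (X j ^ c j) =
      ∑ i ∈ Finset.range (c j + 1), C ((c j).choose i : ZMod 2) * X j ^ (c j + i) := by
    intro j
    rw [map_pow, SqTotal, aeval_X, show (X j + X j ^ 2 : MvPolynomial (Fin k) (ZMod 2)) =
      X j * (X j + 1) by ring, mul_pow, add_pow, Finset.mul_sum]
    refine Finset.sum_congr rfl fun i _ => ?_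
    simp only [one_pow, map_natCast]
    ring
  rw [monomial_eq, C_1, one_mul, Finsupp.prod_fintype _ _ (fun _ => pow_zero _), map_prod]
  simp only [hX]
  rw [Finset.prod_univ_sum]
  refine Finset.sum_congr rfl fun p _ => ?_
  rw [monomial_eq, Finsupp.prod_fintype _ _ (fun _ => pow_zero _), Finset.prod_mul_distrib,
    map_prod]
  simp

theorem coeff_add_SqTotal_monomial (c p : Fin k →₀ ℕ) :
    coeff (c + p) (SqTotal k (monomial c 1)) = ∏ j, ((c j).choose (p j) : ZMod 2) := by
  rw [SqTotal_monomial, coeff_sum]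
  simp only [coeff_monomial, add_right_inj]
  rw [Finset.sum_eq_single (p : Fin k → ℕ)]
  · simp
  · intro q _ hq
    rw [if_neg]
    rintro rfl
    simp at hq
  · intro hp
    simp only [Fintype.mem_piFinset, Finset.mem_range, not_forall, not_lt] at hp
    obtain ⟨j, hj⟩ := hp
    rw [if_pos (by simp)]
    exact Finset.prod_eq_zero (Finset.mem_univ j)
      (by rw [Nat.choose_eq_zero_of_lt hj, Nat.cast_zero])

theorem exists_add_of_coeff_SqTotal_monomial_ne_zero {c v : Fin k →₀ ℕ}
    (h : coeff v (SqTotal k (monomial c 1)) ≠ 0) : ∃ p, v = c + p := by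
  rw [SqTotal_monomial, coeff_sum] at h
  obtain ⟨p, -, hp⟩ := Finset.exists_ne_zero_of_sum_ne_zero h
  rw [coeff_monomial] at hp
  exact ⟨_, (by_contra fun hne => hp (if_neg hne) : _ = v).symm⟩

theorem homogeneousComponent_two_mul_SqTotal_monomial (c : Fin k →₀ ℕ) :
    homogeneousComponent (2 * c.degree) (SqTotal k (monomial c 1)) = monomial c 1 ^ 2 := by
  ext v
  rw [coeff_homogeneousComponent, monomial_pow, one_pow, coeff_monomial]
  by_cases hv : ∃ p, v = c + p
  · obtain ⟨p, rfl⟩ := hv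
    have hdeg : (c + p).degree = 2 * c.degree ↔ p.degree = c.degree := by
      rw [map_add]; omega
    simp only [hdeg, two_smul, add_right_inj, coeff_add_SqTotal_monomial]
    by_cases hcp : c = p
    · subst hcp
      simp
    · rw [if_neg hcp]
      split_ifs with hd
      · by_cases hle : p ≤ c
        · obtain ⟨q, rfl⟩ := exists_add_of_le hle
          rw [map_add] at hd
          have : q = 0 := by rw [← Finsupp.degree_eq_zero_iff]; omega
          simp [this] at hcp
        · rw [Finsupp.le_def] at hle
          push Not at hle
          obtain ⟨j, hj⟩ := hle
          exact Finset.prod_eq_zero (Finset.mem_univ j)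
            (by rw [Nat.choose_eq_zero_of_lt hj, Nat.cast_zero])
      · rfl
  · have h0 : coeff v (SqTotal k (monomial c 1)) = 0 := by
      by_contra h
      exact hv (exists_add_of_coeff_SqTotal_monomial_ne_zero h)
    rw [h0, ite_self, if_neg]
    rintro rfl
    exact hv ⟨c, two_smul _ _⟩

theorem le_degree_of_coeff_SqTotal_ne_zero {f : MvPolynomial (Fin k) (ZMod 2)} {d : ℕ}
    (hf : f.IsHomogeneous d) {v : Fin k →₀ ℕ} (h : coeff v (SqTotal k f) ≠ 0) :
    d ≤ v.degree := by
  rw [f.as_sum, map_sum, coeff_sum] at h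
  obtain ⟨c, hc, hne⟩ := Finset.exists_ne_zero_of_sum_ne_zero h
  have hcd : c.degree = d := by
    by_contra hd
    exact mem_support_iff.1 hc (hf.coeff_eq_zero hd)
  rw [← mul_one (coeff c f), ← smul_eq_mul, ← smul_monomial, map_smul, coeff_smul] at hne
  obtain ⟨p, rfl⟩ := exists_add_of_coeff_SqTotal_monomial_ne_zero (right_ne_zero_of_smul hne)
  rw [map_add]
  omega

theorem isHit_homogeneousComponent_SqTotal {F : MvPolynomial (Fin k) (ZMod 2)} {D : ℕ}
    (hF : homogeneousComponent D F = 0) : IsHit k (homogeneousComponent D (SqTotal k F)) := by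
  rw [← sum_homogeneousComponent F, map_sum, map_sum]
  refine Submodule.sum_mem _ fun d _ => ?_
  have hhom := homogeneousComponent_isHomogeneous d F
  rcases lt_trichotomy d D with hd | rfl | hd
  · by_cases h0 : homogeneousComponent d F = 0
    · rw [h0, map_zero, map_zero]
      exact Submodule.zero_mem _
    · refine Submodule.subset_span ⟨D - d, homogeneousComponent d F, by omega, ?_⟩
      rw [SqOp, hhom.totalDegree h0, Finset.sum_eq_single d]
      · rw [homogeneousComponent_of_mem hhom, if_pos rfl, Nat.add_sub_cancel' hd.le]
      · intro e _ he
        rw [homogeneousComponent_of_mem hhom, if_neg he, map_zero, map_zero]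
      · intro h
        simp at h
  · rw [hF, map_zero, map_zero]
    exact Submodule.zero_mem _
  · convert Submodule.zero_mem _
    ext v
    rw [coeff_homogeneousComponent, coeff_zero]
    split_ifs with hv
    · by_contra h
      exact absurd (le_degree_of_coeff_SqTotal_ne_zero hhom h) (by omega)
    · rfl

theorem homogeneousComponent_mul_pow_two_pow {A : MvPolynomial (Fin k) (ZMod 2)} {r : ℕ}
    (hA : A.IsHomogeneous r) (G : MvPolynomial (Fin k) (ZMod 2)) (t m : ℕ) :
    homogeneousComponent (r + m * 2 ^ t) (A * G ^ 2 ^ t) =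
      A * homogeneousComponent m G ^ 2 ^ t := by
  have hterm : ∀ i, homogeneousComponent (r + m * 2 ^ t) (A * homogeneousComponent i G ^ 2 ^ t) =
      if i = m then A * homogeneousComponent m G ^ 2 ^ t else 0 := by
    intro i
    rw [homogeneousComponent_of_mem
      (hA.mul ((homogeneousComponent_isHomogeneous i G).pow (2 ^ t)))]
    by_cases him : i = m
    · simp [him]
    · rw [if_neg him, if_neg]
      simpa using Ne.symm him
  conv_lhs => rw [← sum_homogeneousComponent G, sum_pow_char_pow, Finset.mul_sum, map_sum]
  simp only [hterm]
  rw [Finset.sum_ite_eq' (Finset.range (G.totalDegree + 1)) m]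
  split_ifs with hm
  · rfl
  · rw [homogeneousComponent_eq_zero _ _ (by simpa using hm), zero_pow (by positivity), mul_zero]

theorem pow_two_pow_eq_expand (G : MvPolynomial (Fin k) (ZMod 2)) (t : ℕ) :
    G ^ 2 ^ t = expand (2 ^ t) G := by
  induction t with
  | zero => simp
  | succ t ih => rw [pow_succ, pow_mul, ih, ← expand_zmod, mul_comm, expand_mul]

theorem wvec_eq_sum (a : Fin k →₀ ℕ) (i : ℕ) : wvec k a i = ∑ j, a j / 2 ^ i % 2 := by
  rw [wvec, Finset.card_filter]
  refine Finset.sum_congr rfl fun j _ => ?_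
  rw [Nat.testBit_eq_decide_div_mod_eq]
  rcases Nat.mod_two_eq_zero_or_one (a j / 2 ^ i) with h | h <;> simp [h]

theorem sum_mod_two_pow (a : Fin k →₀ ℕ) (t : ℕ) :
    ∑ j, a j % 2 ^ t = ∑ i ∈ Finset.range t, 2 ^ i * wvec k a i := by
  induction t with
  | zero => simp [Nat.mod_one]
  | succ t ih =>
    rw [Finset.sum_range_succ, ← ih, wvec_eq_sum, Finset.mul_sum, ← Finset.sum_add_distrib]
    exact Finset.sum_congr rfl fun j _ => Nat.mod_pow_succ

theorem sum_div_two_pow_eq {a b : Fin k →₀ ℕ} {t : ℕ} (hab : ∑ j, a j = ∑ j, b j)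
    (hw : ∀ i < t, wvec k a i = wvec k b i) : ∑ j, a j / 2 ^ t = ∑ j, b j / 2 ^ t := by
  have hmod : ∑ j, a j % 2 ^ t = ∑ j, b j % 2 ^ t := by
    rw [sum_mod_two_pow, sum_mod_two_pow]
    exact Finset.sum_congr rfl fun i hi => by rw [hw i (Finset.mem_range.1 hi)]
  have hsplit : ∀ f : Fin k →₀ ℕ,
      ∑ j, f j = 2 ^ t * ∑ j, f j / 2 ^ t + ∑ j, f j % 2 ^ t := by
    intro f
    rw [Finset.mul_sum, ← Finset.sum_add_distrib]
    exact Finset.sum_congr rfl fun j _ => (Nat.div_add_mod _ _).symm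
  rw [hsplit a, hsplit b, hmod] at hab
  exact Nat.eq_of_mul_eq_mul_left (by positivity) (Nat.add_right_cancel hab)

/-- Steenrod operations strictly lower the weight vector within the binary digits they meet. -/
theorem exists_wvec_lt_of_odd_choose {c p u : Fin k →₀ ℕ} {t : ℕ} (hc : ∀ j, c j < 2 ^ t)
    (hp : p ≠ 0) (hodd : ∀ j, ((c j).choose (p j) : ZMod 2) ≠ 0) :
    ∃ q < t, (∀ i < q, wvec k (c + p + 2 ^ t • u) i = wvec k c i) ∧
      wvec k (c + p + 2 ^ t • u) q < wvec k c q := by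
  classical
  have hex : ∃ q, ∃ j, (p j).testBit q = true := by
    by_contra! h
    exact hp (Finsupp.ext fun j => Nat.eq_of_testBit_eq fun i => by simpa using h i j)
  set q := Nat.find hex with hq
  obtain ⟨j₀, hj₀⟩ : ∃ j, (p j).testBit q = true := Nat.find_spec hex
  have hlow : ∀ i < q, ∀ j, (p j).testBit i = false := fun i hi j => by
    have := Nat.find_min hex hi
    simpa using (not_exists.1 this) j
  have hdvd : ∀ j, ∃ v, p j = 2 ^ q * v := fun j => by
    refine Nat.dvd_of_mod_eq_zero (Nat.eq_of_testBit_eq fun i => ?_)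
    rw [Nat.testBit_mod_two_pow, Nat.zero_testBit]
    by_cases hi : i < q
    · simp [hlow i hi j]
    · simp [hi]
  have hqt : q < t := by
    by_contra! h
    have h1 := testBit_of_odd_choose (hodd j₀) hj₀
    rw [Nat.testBit_lt_two_pow ((hc j₀).trans_le (Nat.pow_le_pow_right two_pos h))] at h1
    exact absurd h1 (by simp)
  have hu : ∀ (x y i : ℕ), i < t → (x + 2 ^ t * y).testBit i = x.testBit i := by
    intro x y i hi
    have := Nat.testBit_mod_two_pow (x + 2 ^ t * y) t i
    rw [Nat.add_mul_mod_self_left, Nat.testBit_mod_two_pow] at this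
    simpa [hi] using this.symm
  have hv' : ∀ j i, i < t → ((c + p + 2 ^ t • u) j).testBit i = (c j + p j).testBit i :=
    fun j i hi => hu _ _ i hi
  have hflip : ∀ j, (c j + p j).testBit q = ((p j).testBit q ^^ (c j).testBit q) := by
    intro j
    obtain ⟨v, hv⟩ := hdvd j
    have h2 : (c j + p j) / 2 ^ q = c j / 2 ^ q + v := by
      rw [hv, Nat.add_mul_div_left _ _ (by positivity)]
    have h3 : p j / 2 ^ q = v := by
      rw [hv, Nat.mul_div_cancel_left _ (by positivity)]
    simp only [Nat.testBit_eq_decide_div_mod_eq, h2, h3]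
    rcases Nat.mod_two_eq_zero_or_one (c j / 2 ^ q) with h | h <;>
      rcases Nat.mod_two_eq_zero_or_one v with h' | h' <;> simp [h, h', Nat.add_mod]
  refine ⟨q, hqt, fun i hi => ?_, ?_⟩
  · unfold wvec
    congr 1
    refine Finset.filter_congr fun j _ => ?_
    obtain ⟨v, hv⟩ := hdvd j
    have h4 : (c j + p j).testBit i = (c j).testBit i := by
      have := Nat.testBit_mod_two_pow (c j + p j) q i
      rw [hv, Nat.add_mul_mod_self_left, Nat.testBit_mod_two_pow, ← hv] at this
      simpa [hi] using this.symm
    rw [hv' j i (hi.trans hqt), h4]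
  · unfold wvec
    refine Finset.card_lt_card (Finset.ssubset_iff_of_subset ?_ |>.2 ⟨j₀, ?_, ?_⟩)
    · intro j
      rw [Finset.mem_filter, Finset.mem_filter, hv' j q hqt, hflip]
      rintro ⟨hj, h⟩
      refine ⟨hj, ?_⟩
      by_cases hb : (p j).testBit q = true
      · exact testBit_of_odd_choose (hodd j) hb
      · simpa [hb] using h
    · rw [Finset.mem_filter]
      exact ⟨Finset.mem_univ _, testBit_of_odd_choose (hodd j₀) hj₀⟩
    · rw [Finset.mem_filter, hv' j₀ q hqt, hflip, hj₀, testBit_of_odd_choose (hodd j₀) hj₀]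
      simp

theorem SqTotal_sum_X_pow_two_pow (j : Fin k) (N : ℕ) :
    SqTotal k (∑ i ∈ Finset.range N, X j ^ 2 ^ i) = X j + X j ^ 2 ^ N := by
  induction N with
  | zero => simp [CharTwo.add_self_eq_zero]
  | succ N ih =>
    rw [Finset.sum_range_succ, map_add, ih, map_pow, SqTotal, aeval_X, add_pow_char_pow,
      ← pow_mul, ← pow_succ', add_assoc, ← add_assoc (X j ^ 2 ^ N), CharTwo.add_self_eq_zero,
      zero_add]

theorem homogeneousComponent_prod_mul_eq (E : Finset (Fin k)) (N m : ℕ) (hm : m < 2 ^ N)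
    (H : MvPolynomial (Fin k) (ZMod 2)) :
    homogeneousComponent m ((∏ j ∈ E, (X j + X j ^ 2 ^ N)) * H) =
      homogeneousComponent m ((∏ j ∈ E, X j) * H) := by
  set S : Set (Fin k →₀ ℕ) := Set.range fun j => Finsupp.single j (2 ^ N) with hS
  set I : Ideal (MvPolynomial (Fin k) (ZMod 2)) :=
    Ideal.span ((fun s => monomial s (1 : ZMod 2)) '' S) with hI
  have hX : ∀ j : Fin k, (X j ^ 2 ^ N : MvPolynomial (Fin k) (ZMod 2)) ∈ I := fun j =>
    Ideal.subset_span ⟨_, ⟨j, rfl⟩, (X_pow_eq_monomial).symm⟩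
  have hmem : (∏ j ∈ E, (X j + X j ^ 2 ^ N)) * H - (∏ j ∈ E, X j) * H ∈ I := by
    rw [← Ideal.Quotient.eq, map_mul, map_mul, map_prod, map_prod]
    congr 1
    refine Finset.prod_congr rfl fun j _ => ?_
    rw [Ideal.Quotient.eq, add_sub_cancel_left]
    exact hX j
  rw [← sub_eq_zero, ← map_sub]
  ext v
  rw [coeff_homogeneousComponent, coeff_zero]
  split_ifs with hv
  · by_contra h
    obtain ⟨_, ⟨j, rfl⟩, hle⟩ := mem_ideal_span_monomial_image.1 hmem v (mem_support_iff.2 h)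
    have h1 := Finsupp.le_degree j v
    have h2 := hle j
    simp only [Finsupp.single_eq_same] at h2
    omega
  · rfl

/-- A product of sums `∑ X j ^ 2 ^ i` has components only in degrees that are sums of `E.card`
powers of two. -/
theorem homogeneousComponent_prod_sum_mul_eq_zero (E : Finset (Fin k)) (N : ℕ) {m d : ℕ}
    {H : MvPolynomial (Fin k) (ZMod 2)} (hH : H.IsHomogeneous d)
    (hm : ∀ u : Fin k → ℕ, ∑ j ∈ E, 2 ^ u j + d ≠ m) :
    homogeneousComponent m ((∏ j ∈ E, ∑ i ∈ Finset.range N, X j ^ 2 ^ i) * H) = 0 := by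
  rw [Finset.prod_sum, Finset.sum_mul, map_sum]
  refine Finset.sum_eq_zero fun p _ => ?_
  have hhom : (∏ x ∈ E.attach, (X x.1 : MvPolynomial (Fin k) (ZMod 2)) ^ 2 ^ p x.1 x.2 :
      MvPolynomial (Fin k) (ZMod 2)).IsHomogeneous (∑ x ∈ E.attach, 2 ^ p x.1 x.2) :=
    IsHomogeneous.prod _ _ _ fun x _ => isHomogeneous_X_pow _ _
  rw [homogeneousComponent_of_mem (hhom.mul hH), if_neg]
  have h := hm fun j => if hj : j ∈ E then p j hj else 0
  rw [← Finset.sum_attach] at h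
  simpa using h.symm

theorem IsMinimalSpike.wvec_le_card {b : Fin k →₀ ℕ} (hb : IsMinimalSpike k b) (t : ℕ)
    {κ : Type*} (E : Finset κ) (u : κ → ℕ)
    (h : ∑ j, b j / 2 ^ t = ∑ i ∈ E, (2 ^ u i - 1)) : wvec k b t ≤ E.card := by
  obtain ⟨r, s, hbs, hstrict, hmono, -, hzero⟩ := hb
  have hdiv : ∀ j, b j / 2 ^ t = 2 ^ (s j - t) - 1 := by
    intro j
    rw [hbs]
    rcases le_total t (s j) with hts | hts
    · obtain ⟨e, he⟩ := Nat.exists_eq_add_of_le hts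
      rw [he, Nat.add_sub_cancel_left, pow_add]
      have h1 := @Nat.one_le_two_pow e
      have h2 := @Nat.one_le_two_pow t
      obtain ⟨f, hf⟩ := Nat.exists_eq_add_of_le h1
      rw [hf, Nat.add_sub_cancel_left, mul_add, mul_one, add_comm, Nat.add_sub_assoc h2, add_comm,
        Nat.add_mul_div_left _ _ (by positivity), Nat.div_eq_of_lt (by omega), zero_add]
    · have h1 := Nat.pow_le_pow_right two_pos hts
      have h2 := @Nat.one_le_two_pow (s j)
      rw [Nat.sub_eq_zero_of_le hts, Nat.div_eq_of_lt (by omega)]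
      rfl
  set J : Finset (Fin k) := Finset.univ.filter fun j => t < s j with hJ
  have hwJ : wvec k b t = J.card := by
    rw [wvec, hJ]
    congr 1
    refine Finset.filter_congr fun j _ => ?_
    rw [hbs, Nat.testBit_two_pow_sub_one, decide_eq_true_eq]
  rw [hwJ]
  have hsum : ∑ j ∈ J, (2 ^ (s j - t) - 1) = ∑ i ∈ E, (2 ^ u i - 1) := by
    rw [← h, hJ, Finset.sum_filter]
    refine Finset.sum_congr rfl fun j _ => ?_
    rw [hdiv]
    split_ifs with hj
    · rfl
    · rw [Nat.sub_eq_zero_of_le (not_lt.1 hj)]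
      rfl
  rcases J.eq_empty_or_nonempty with h0 | hne
  · simp [h0]
  have hmemJ : ∀ j, j ∈ J ↔ t < s j := fun j => by simp [hJ]
  set l := J.max' hne with hl
  have hlJ : l ∈ J := J.max'_mem hne
  have hls : t < s l := (hmemJ l).1 hlJ
  have hlr : (l : ℕ) < r := by
    by_contra! hr
    rw [hzero l hr] at hls
    omega
  have hlt : ∀ j ∈ J.erase l, j < l := fun j hj =>
    lt_of_le_of_ne (J.le_max' j (Finset.mem_of_mem_erase hj)) (Finset.ne_of_mem_erase hj)
  have hanti : ∀ i ∈ J.erase l, ∀ j ∈ J.erase l, i < j → s j < s i := fun i _ j hj hij => by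
    have := hlt j hj
    rw [Fin.lt_def] at this
    exact hstrict i j hij (by omega)
  refine card_le_of_sum_two_pow_sub_one_eq hlJ (σ := fun j => s j - t) ?_ ?_ (by omega) E u hsum
  · intro i hi j hj hij
    have hi' := (hmemJ i).1 (Finset.mem_of_mem_erase hi)
    have hj' := (hmemJ j).1 (Finset.mem_of_mem_erase hj)
    simp only at hij
    rcases lt_trichotomy i j with hlt' | heq | hgt
    · have := hanti i hi j hj hlt'
      omega
    · exact heq
    · have := hanti j hj i hi hgt
      omega
  · intro j hj
    have := hmono j l (hlt j hj) hlr
    exact Nat.sub_le_sub_right this t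

theorem isHit_monomial_of_wvec_lt {b : Fin k →₀ ℕ} (hb : IsMinimalSpike k b) (t : ℕ)
    (a : Fin k →₀ ℕ) (hab : ∑ j, a j = ∑ j, b j) (hlow : ∀ i < t, wvec k a i = wvec k b i)
    (hlt : wvec k a t < wvec k b t) : IsHit k (monomial a (1 : ZMod 2)) := by
  classical
  induction t using Nat.strong_induction_on generalizing a with
  | _ t ih =>
  set c : Fin k →₀ ℕ := a.mapRange (· % 2 ^ t) (Nat.zero_mod _) with hc
  set y : Fin k →₀ ℕ := a.mapRange (· / 2 ^ (t + 1)) (Nat.zero_div _) with hy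
  set E : Finset (Fin k) := Finset.univ.filter fun j => (a j).testBit t with hE
  set m := E.card + 2 * y.degree with hm
  set e : Fin k →₀ ℕ := ∑ j ∈ E, Finsupp.single j 1 with he
  have hediv : ∀ j, a j / 2 ^ t = e j + 2 * y j := by
    intro j
    have h1 : e j = a j / 2 ^ t % 2 := by
      rw [he, Finsupp.finsetSum_apply]
      simp only [Finsupp.single_apply, Finset.sum_ite_eq', hE, Finset.mem_filter,
        Finset.mem_univ, true_and, Nat.testBit_eq_decide_div_mod_eq, decide_eq_true_eq]
      split_ifs <;> omega
    have h2 : y j = a j / 2 ^ t / 2 := by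
      rw [hy, Finsupp.mapRange_apply, pow_succ, Nat.div_div_eq_div_mul]
    omega
  have hace : a = c + 2 ^ t • (e + 2 • y) := by
    ext j
    simp only [Finsupp.add_apply, Finsupp.smul_apply, smul_eq_mul, ← hediv, hc,
      Finsupp.mapRange_apply, Nat.mod_add_div]
  have hedeg : e.degree = E.card := by simp [he]
  have hdeg : a.degree = c.degree + m * 2 ^ t := by
    conv_lhs => rw [hace]
    simp only [map_add, map_nsmul, hedeg, smul_eq_mul, hm]
    ring
  have hrep : ∀ u : Fin k → ℕ, ∑ j ∈ E, 2 ^ u j + y.degree ≠ m := by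
    intro u hu
    have h1 : ∑ j, b j / 2 ^ t = m := by
      rw [← sum_div_two_pow_eq hab hlow]
      simp only [hediv, Finset.sum_add_distrib, ← Finset.mul_sum, hm]
      rw [← hedeg, Finsupp.degree_eq_sum, Finsupp.degree_eq_sum]
    have h2 : ∑ j, b j / 2 ^ t = ∑ j ∈ E, (2 ^ (u j + 1) - 1) := by
      have h3 := sum_two_pow_sub_one_add_card E (fun j => u j + 1)
      simp only [pow_succ, ← Finset.sum_mul] at h3 ⊢
      omega
    exact absurd (hb.wvec_le_card t E _ h2) (not_le.2 hlt)
  set F : MvPolynomial (Fin k) (ZMod 2) :=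
    (∏ j ∈ E, ∑ i ∈ Finset.range m, X j ^ 2 ^ i) * monomial y 1 with hF
  have hF0 : homogeneousComponent m F = 0 :=
    homogeneousComponent_prod_sum_mul_eq_zero E m (isHomogeneous_monomial 1 rfl) hrep
  have hprod : (∏ j ∈ E, X j : MvPolynomial (Fin k) (ZMod 2)) = monomial e 1 := by
    rw [he, monomial_sum_one]
    rfl
  have hG : homogeneousComponent m (SqTotal k F) = monomial (e + 2 • y) 1 := by
    rw [hF, map_mul, map_prod]
    simp only [SqTotal_sum_X_pow_two_pow]
    rw [homogeneousComponent_prod_mul_eq E m m Nat.lt_two_pow_self, hprod]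
    have h1 := homogeneousComponent_mul_pow_two_pow
      (isHomogeneous_monomial (1 : ZMod 2) hedeg) (SqTotal k (monomial y 1)) 0 (2 * y.degree)
    rw [pow_zero, mul_one, pow_one, pow_one,
      homogeneousComponent_two_mul_SqTotal_monomial, monomial_pow, monomial_mul, one_pow,
      mul_one] at h1
    exact h1
  have hc_hom : (monomial c (1 : ZMod 2)).IsHomogeneous c.degree := isHomogeneous_monomial 1 rfl
  have hhit := isHit_homogeneousComponent_SqTotal (k := k)
    (F := monomial c 1 * F ^ 2 ^ t) (D := c.degree + m * 2 ^ t)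
    (by rw [homogeneousComponent_mul_pow_two_pow hc_hom, hF0, zero_pow (by positivity), mul_zero])
  have hsplit : SqTotal k (monomial c 1 * F ^ 2 ^ t) = monomial c 1 * SqTotal k F ^ 2 ^ t +
      (SqTotal k (monomial c 1) - monomial c 1) * SqTotal k F ^ 2 ^ t := by
    rw [map_mul, map_pow]
    ring
  rw [hsplit, map_add, homogeneousComponent_mul_pow_two_pow hc_hom, hG, monomial_pow,
    monomial_mul, one_pow, mul_one, ← hace] at hhit
  refine (Submodule.add_mem_iff_left _ ?_).1 hhit
  rw [homogeneousComponent_apply]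
  refine Submodule.sum_mem _ fun v hv => ?_
  rw [Finset.mem_filter] at hv
  obtain ⟨hv, hvdeg⟩ := hv
  obtain ⟨v₁, hv₁, v₂, hv₂, rfl⟩ := Finset.mem_add.1 (support_mul _ _ hv)
  rw [pow_two_pow_eq_expand] at hv₂
  obtain ⟨u, -, rfl⟩ := Finset.mem_image.1 (support_expand_subset _ hv₂)
  obtain ⟨p, rfl, hp, hodd⟩ : ∃ p, v₁ = c + p ∧ p ≠ 0 ∧
      ∀ j, ((c j).choose (p j) : ZMod 2) ≠ 0 := by
    rw [mem_support_iff, coeff_sub, coeff_monomial] at hv₁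
    have hne : v₁ ≠ c := by
      intro h
      have := coeff_add_SqTotal_monomial c 0
      rw [add_zero] at this
      simp [h, this] at hv₁
    rw [if_neg hne.symm, sub_zero] at hv₁
    obtain ⟨p, rfl⟩ := exists_add_of_coeff_SqTotal_monomial_ne_zero hv₁
    rw [coeff_add_SqTotal_monomial] at hv₁
    exact ⟨p, rfl, fun h => hne (by rw [h, add_zero]),
      fun j => Finset.prod_ne_zero_iff.1 hv₁ j (Finset.mem_univ j)⟩
  obtain ⟨q, hqt, hqeq, hqlt⟩ := exists_wvec_lt_of_odd_choose (u := u)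
    (fun j => Nat.mod_lt (a j) (by positivity : 0 < 2 ^ t)) hp hodd
  have hwc : ∀ i < t, wvec k c i = wvec k b i := by
    intro i hi
    rw [← hlow i hi, wvec, wvec]
    congr 1
    refine Finset.filter_congr fun j _ => ?_
    rw [hc, Finsupp.mapRange_apply, Nat.testBit_mod_two_pow]
    simp [hi]
  have hterm := ih q hqt (c + p + 2 ^ t • u)
    (by rw [← hab, ← Finsupp.degree_eq_sum, ← Finsupp.degree_eq_sum, hvdeg, hdeg])
    (fun i hi => (hqeq i hi).trans (hwc i (hi.trans hqt)))
    (hqlt.trans_eq (hwc q hqt))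
  rw [← mul_one (coeff _ _), ← smul_eq_mul, ← smul_monomial]
  exact Submodule.smul_mem _ _ hterm

end

/-- Singer's criterion: if `x` is a monomial of degree `n` with `μ(n) ≤ k`, `z` is a
minimal spike of degree `n`, and `ω(x) < ω(z)` in the left lexicographic order,
then `x` is hit. -/
theorem stmt13 (k n : ℕ) (hn : 0 < n) (hmu : muNat n ≤ k)
    (a b : Fin k →₀ ℕ)
    (ha : ∑ j, a j = n) (hb : ∑ j, b j = n)
    (hspike : IsMinimalSpike k b)
    (hw : wlt (wvec k a) (wvec k b)) :
    IsHit k (MvPolynomial.monomial a (1 : ZMod 2)) := by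
  obtain ⟨t, hlow, hlt⟩ := hw
  exact isHit_monomial_of_wvec_lt hspike t a (ha.trans hb.symm) hlow hlt
end

section
/- Let x be a monomial of degree n in P_k and let t be the number of ones in the binary expansion of ν_1(x). Then there exist finitely many monomials x̄_1, …, x̄_q of degree n in P_k, each satisfying ν_1(x̄_j) = 2^t − 1, such that x − (x̄_1 + … + x̄_q) is hit. -/
open MvPolynomial

/-- `α(n)`: the number of ones in the binary expansion of `n`. -/
def alphaCount (n : ℕ) : ℕ := ((Finset.range (n + 1)).filter fun i => n.testBit i).card

/-- The Steenrod squares as the coefficients of one algebra map into polynomials in a grading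
parameter `T`, with `x_j ↦ x_j + x_j^2 T`. -/
noncomputable def gradedSq (k : ℕ) :
    MvPolynomial (Fin k) (ZMod 2) →ₐ[ZMod 2] Polynomial (MvPolynomial (Fin k) (ZMod 2)) :=
  aeval fun j => Polynomial.C (X j) + Polynomial.C (X j ^ 2) * Polynomial.X

theorem gradedSq_X (k : ℕ) (j : Fin k) :
    gradedSq k (X j) = Polynomial.C (X j) + Polynomial.C (X j ^ 2) * Polynomial.X := by
  simp [gradedSq]

theorem gradedSq_C (k : ℕ) (r : ZMod 2) :
    gradedSq k (C r) = Polynomial.C (C r) :=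
  (gradedSq k).commutes r

theorem gradedSq_coeff_zero (k : ℕ) (f : MvPolynomial (Fin k) (ZMod 2)) :
    (gradedSq k f).coeff 0 = f := by
  induction f using MvPolynomial.induction_on with
  | C r => simp
  | add p q hp hq => simp [hp, hq]
  | mul_X p j hp => simp [gradedSq_X, Polynomial.mul_coeff_zero, hp]

theorem gradedSq_eval_one (k : ℕ) (f : MvPolynomial (Fin k) (ZMod 2)) :
    (gradedSq k f).eval 1 = SqTotal k f := by
  induction f using MvPolynomial.induction_on with
  | C r => rw [gradedSq_C, Polynomial.eval_C]; exact ((SqTotal k).commutes r).symm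
  | add p q hp hq => simp [hp, hq]
  | mul_X p j hp => simp [gradedSq_X, hp, SqTotal]

theorem gradedSq_coeff_mul (k : ℕ) (f g : MvPolynomial (Fin k) (ZMod 2)) (n : ℕ) :
    (gradedSq k (f * g)).coeff n =
      ∑ p ∈ Finset.HasAntidiagonal.antidiagonal n, (gradedSq k f).coeff p.1 * (gradedSq k g).coeff p.2 := by
  rw [map_mul, Polynomial.coeff_mul]

theorem gradedSq_coeff_X_pow (k : ℕ) (j : Fin k) (a i : ℕ) :
    (gradedSq k (X j ^ a)).coeff i =
      (a.choose i : MvPolynomial (Fin k) (ZMod 2)) * X j ^ (a + i) := by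
  have h : gradedSq k (X j ^ a) =
      Polynomial.C (X j ^ a) * ((1 + Polynomial.X) ^ a : Polynomial _).comp
        (Polynomial.C (X j) * Polynomial.X) := by
    rw [map_pow, gradedSq_X]
    simp only [Polynomial.pow_comp, Polynomial.add_comp, Polynomial.one_comp, Polynomial.X_comp,
      map_pow]
    rw [← mul_pow]
    ring
  rw [h, Polynomial.coeff_C_mul, Polynomial.comp_C_mul_X_coeff, Polynomial.coeff_one_add_X_pow]
  ring

theorem isHomogeneous_gradedSq_coeff {k d : ℕ} {f : MvPolynomial (Fin k) (ZMod 2)}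
    (hf : f.IsHomogeneous d) (i : ℕ) : ((gradedSq k f).coeff i).IsHomogeneous (d + i) := by
  have hmul : ∀ {p q : MvPolynomial (Fin k) (ZMod 2)} {d e : ℕ},
      (∀ i, ((gradedSq k p).coeff i).IsHomogeneous (d + i)) →
      (∀ i, ((gradedSq k q).coeff i).IsHomogeneous (e + i)) →
      ∀ i, ((gradedSq k (p * q)).coeff i).IsHomogeneous (d + e + i) := by
    intro p q d e hp hq i
    rw [gradedSq_coeff_mul]
    refine IsHomogeneous.sum _ _ _ fun x hx => ?_
    rw [Finset.HasAntidiagonal.mem_antidiagonal] at hx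
    have := (hp x.1).mul (hq x.2)
    rwa [show d + x.1 + (e + x.2) = d + e + i by omega] at this
  have hC : ∀ (r : ZMod 2) i, ((gradedSq k (C r)).coeff i).IsHomogeneous (0 + i) := by
    intro r i
    rw [gradedSq_C, Polynomial.coeff_C]
    split_ifs with h
    · subst h; exact isHomogeneous_C _ _
    · exact isHomogeneous_zero _ _ _
  have hX : ∀ (j : Fin k) i, ((gradedSq k (X j)).coeff i).IsHomogeneous (1 + i) := by
    intro j i
    have := gradedSq_coeff_X_pow k j 1 i
    rw [pow_one] at this
    rw [this, ← map_natCast (C : ZMod 2 →+* MvPolynomial (Fin k) (ZMod 2))]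
    exact (isHomogeneous_X_pow j (1 + i)).C_mul _
  have hmon : ∀ (m : Fin k →₀ ℕ) (r : ZMod 2) i,
      ((gradedSq k (monomial m r)).coeff i).IsHomogeneous (m.degree + i) := by
    intro m r
    induction m using Finsupp.induction_linear generalizing r with
    | zero => simpa using hC r
    | add m m' hm hm' =>
      have : monomial (m + m') r = monomial m r * monomial m' (1 : ZMod 2) := by
        rw [monomial_mul, mul_one]
      rw [this, map_add]
      exact hmul (hm r) (hm' 1)
    | single j e =>
      induction e generalizing r with
      | zero => simpa using hC r
      | succ e ih =>
        have : monomial (Finsupp.single j (e + 1)) r =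
            monomial (Finsupp.single j e) r * (X j : MvPolynomial (Fin k) (ZMod 2)) := by
          rw [X, monomial_mul, mul_one, ← Finsupp.single_add]
        rw [this, Finsupp.degree_single]
        have h2 := hmul (ih r) (hX j)
        rwa [Finsupp.degree_single] at h2
  rw [f.as_sum, map_sum, Polynomial.finsetSum_coeff]
  refine IsHomogeneous.sum _ _ _ fun m hm => ?_
  have h := hmon m (coeff m f) i
  have hd : m.degree = d := by
    rw [Finsupp.degree_eq_weight_one]
    exact hf (mem_support_iff.1 hm)
  rwa [hd] at h

theorem gradedSq_coeff_mem_supported {k : ℕ} {s : Set (Fin k)}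
    {f : MvPolynomial (Fin k) (ZMod 2)} (hf : f ∈ supported (ZMod 2) s) (i : ℕ) :
    (gradedSq k f).coeff i ∈ supported (ZMod 2) s := by
  rw [supported] at hf
  induction hf using Algebra.adjoin_induction generalizing i with
  | mem x hx =>
    obtain ⟨j, hj, rfl⟩ := hx
    have := gradedSq_coeff_X_pow k j 1 i
    rw [pow_one] at this
    rw [this]
    exact mul_mem (natCast_mem _ _) (pow_mem (X_mem_supported.2 hj) _)
  | algebraMap r =>
    rw [AlgHom.commutes, Polynomial.algebraMap_apply, Polynomial.coeff_C]
    split_ifs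
    · exact algebraMap_mem _ r
    · exact zero_mem _
  | add p q _ _ hp hq =>
    rw [map_add, Polynomial.coeff_add]
    exact add_mem (hp i) (hq i)
  | mul p q _ _ hp hq =>
    rw [gradedSq_coeff_mul]
    exact sum_mem fun x _ => mul_mem (hp _) (hq _)

theorem SqOp_eq_gradedSq_coeff {k d : ℕ} {f : MvPolynomial (Fin k) (ZMod 2)}
    (hf : f.IsHomogeneous d) (i : ℕ) : SqOp k i f = (gradedSq k f).coeff i := by
  rcases eq_or_ne f 0 with rfl | hf0
  · simp [SqOp]
  have hcomp : homogeneousComponent (d + i) (SqTotal k f) = (gradedSq k f).coeff i := by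
    rw [← gradedSq_eval_one, Polynomial.eval_eq_sum_range' (n := (gradedSq k f).natDegree + i + 1)
      (by omega), map_sum]
    simp only [one_pow, mul_one]
    rw [Finset.sum_eq_single i]
    · exact (homogeneousComponent_of_mem (isHomogeneous_gradedSq_coeff hf i)).trans (if_pos rfl)
    · intro b _ hb
      exact (homogeneousComponent_of_mem (isHomogeneous_gradedSq_coeff hf b)).trans
        (if_neg (by omega))
    · intro h
      exact absurd (Finset.mem_range.2 (by omega)) h
  rw [SqOp, hf.totalDegree hf0, Finset.sum_eq_single d, ← hcomp]
  · rw [homogeneousComponent_of_mem hf, if_pos rfl]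
  · intro b _ hb
    rw [homogeneousComponent_of_mem hf, if_neg (by omega), map_zero, map_zero]
  · intro h
    exact absurd (Finset.mem_range.2 (by omega)) h

theorem gradedSq_coeff_mem_hitSubmodule {k d i : ℕ} {f : MvPolynomial (Fin k) (ZMod 2)}
    (hf : f.IsHomogeneous d) (hi : 0 < i) : (gradedSq k f).coeff i ∈ hitSubmodule k :=
  Submodule.subset_span ⟨i, f, hi, (SqOp_eq_gradedSq_coeff hf i).symm⟩

/-- Integration by parts modulo hit polynomials: `Sq^n(u) v` is congruent to `u v'`, where `v'`
depends only on `v` and `n` (it is the conjugate square of `v`). -/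
theorem exists_conjugate_gradedSq {k : ℕ} {s : Set (Fin k)} (n : ℕ) :
    ∀ (d : ℕ) (v : MvPolynomial (Fin k) (ZMod 2)), v.IsHomogeneous d →
      v ∈ supported (ZMod 2) s →
      ∃ v' : MvPolynomial (Fin k) (ZMod 2), v'.IsHomogeneous (d + n) ∧
        v' ∈ supported (ZMod 2) s ∧
        ∀ (e : ℕ) (u : MvPolynomial (Fin k) (ZMod 2)), u.IsHomogeneous e →
          (gradedSq k u).coeff n * v - u * v' ∈ hitSubmodule k := by
  induction n using Nat.strong_induction_on with
  | _ n ih =>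
  intro d v hv hvs
  rcases Nat.eq_zero_or_pos n with rfl | hn
  · exact ⟨v, hv, hvs, fun e u _ => by simp [gradedSq_coeff_zero]⟩
  have hstep : ∀ i : Fin n, ∃ w : MvPolynomial (Fin k) (ZMod 2), w.IsHomogeneous (d + n) ∧
      w ∈ supported (ZMod 2) s ∧
      ∀ (e : ℕ) (u : MvPolynomial (Fin k) (ZMod 2)), u.IsHomogeneous e →
        (gradedSq k u).coeff i * (gradedSq k v).coeff (n - i) - u * w ∈ hitSubmodule k := by
    intro i
    obtain ⟨w, hw, hws, hwu⟩ := ih i i.2 _ _ (isHomogeneous_gradedSq_coeff hv (n - i))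
      (gradedSq_coeff_mem_supported hvs (n - i))
    rw [show d + (n - (i : ℕ)) + i = d + n by omega] at hw
    exact ⟨w, hw, hws, hwu⟩
  choose w hw hws hwu using hstep
  refine ⟨-∑ i, w i, (IsHomogeneous.sum _ _ _ fun i _ => hw i).neg,
    neg_mem (sum_mem fun i _ => hws i), fun e u hu => ?_⟩
  have h1 := gradedSq_coeff_mem_hitSubmodule (hu.mul hv) hn
  have h2 := sum_mem fun i (_ : i ∈ Finset.univ) => hwu i e u hu
  rw [gradedSq_coeff_mul, Finset.Nat.sum_antidiagonal_eq_sum_range_succ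
    (fun i j => (gradedSq k u).coeff i * (gradedSq k v).coeff j), Finset.sum_range_succ,
    Nat.sub_self, gradedSq_coeff_zero, Finset.sum_range] at h1
  convert sub_mem h1 h2 using 1
  rw [Finset.sum_sub_distrib, ← Finset.mul_sum]
  ring

theorem alphaCount_eq_sum {n N : ℕ} (h : n < N) :
    alphaCount n = ∑ i ∈ Finset.range N, (n.testBit i).toNat := by
  have hsub : Finset.range (n + 1) ⊆ Finset.range N := Finset.range_subset_range.2 h
  rw [alphaCount, Finset.card_filter, ← Finset.sum_subset hsub]
  · exact Finset.sum_congr rfl fun i _ => by cases n.testBit i <;> rfl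
  · intro i _ hi
    rw [Finset.mem_range, not_lt] at hi
    rw [Nat.testBit_lt_two_pow (lt_trans (by omega : n < i) Nat.lt_two_pow_self), Bool.toNat_false]

theorem alphaCount_two_mul (c : ℕ) : alphaCount (2 * c) = alphaCount c := by
  rw [alphaCount_eq_sum (show 2 * c < 2 * c + 1 + 1 by omega), Finset.sum_range_succ',
    alphaCount_eq_sum (show c < 2 * c + 1 by omega)]
  simp [Nat.testBit_succ]

theorem alphaCount_two_mul_add_one (c : ℕ) : alphaCount (2 * c + 1) = alphaCount c + 1 := by
  rw [alphaCount_eq_sum (show 2 * c + 1 < 2 * c + 1 + 1 by omega), Finset.sum_range_succ',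
    alphaCount_eq_sum (show c < 2 * c + 1 by omega)]
  simp [Nat.testBit_succ, Nat.mul_add_div]

theorem odd_choose_two_mul_add {c e m : ℕ} (he : e < 2) (h : Odd (c.choose m)) :
    Odd ((2 * c + e).choose (2 * m)) := by
  have := Choose.choose_modEq_choose_mod_mul_choose_div_nat (n := 2 * c + e) (k := 2 * m) (p := 2)
  rw [show (2 * m) % 2 = 0 by omega, show 2 * m / 2 = m by omega,
    show (2 * c + e) / 2 = c by omega, Nat.choose_zero_right, one_mul] at this
  rw [Nat.odd_iff] at h ⊢
  exact Eq.trans this h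

/-- A number other than `2^t - 1`, with `t` binary ones, has a binary one which can be moved one
place down. -/
theorem eq_or_exists_odd_choose (a : ℕ) :
    a + 1 = 2 ^ alphaCount a ∨
      ∃ a' b, a = a' + 2 ^ b ∧ alphaCount a' = alphaCount a ∧ Odd (a'.choose (2 ^ b)) := by
  induction a using Nat.strong_induction_on with
  | _ a ih =>
  obtain ⟨c, rfl | rfl⟩ := Nat.even_or_odd' a
  · rcases Nat.even_or_odd' c with ⟨m, rfl | rfl⟩
    · rcases Nat.eq_zero_or_pos m with rfl | hm
      · exact Or.inl (by simp [alphaCount])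
      rcases ih (2 * m) (by omega) with h | ⟨a', b, h, hα, hodd⟩
      · rcases hα : alphaCount (2 * m) with _ | s
        · rw [hα] at h; omega
        · rw [hα, pow_succ] at h; omega
      · refine Or.inr ⟨2 * a', b + 1, ?_, ?_, ?_⟩
        · rw [pow_succ]; omega
        · rw [alphaCount_two_mul, alphaCount_two_mul, hα]
        · rw [pow_succ']; exact odd_choose_two_mul_add (e := 0) (by omega) hodd
    · refine Or.inr ⟨2 * (2 * m) + 1, 0, by omega, ?_, ?_⟩
      · simp only [alphaCount_two_mul, alphaCount_two_mul_add_one]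
      · rw [pow_zero, Nat.choose_one_right]; exact odd_two_mul_add_one _
  · rcases ih c (by omega) with h | ⟨a', b, h, hα, hodd⟩
    · left
      rw [alphaCount_two_mul_add_one, pow_succ]; omega
    · refine Or.inr ⟨2 * a' + 1, b + 1, ?_, ?_, ?_⟩
      · rw [pow_succ]; omega
      · rw [alphaCount_two_mul_add_one, alphaCount_two_mul_add_one, hα]
      · rw [pow_succ']; exact odd_choose_two_mul_add (e := 1) (by omega) hodd

theorem exists_X_pow_mul_sub_mem_hitSubmodule {k : ℕ} {s : Set (Fin k)} (j : Fin k) (a : ℕ) :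
    ∀ (d : ℕ) (v : MvPolynomial (Fin k) (ZMod 2)), v.IsHomogeneous d →
      v ∈ supported (ZMod 2) s →
      ∃ (d' : ℕ) (v' : MvPolynomial (Fin k) (ZMod 2)), d' + (2 ^ alphaCount a - 1) = d + a ∧
        v'.IsHomogeneous d' ∧ v' ∈ supported (ZMod 2) s ∧
        X j ^ a * v - X j ^ (2 ^ alphaCount a - 1) * v' ∈ hitSubmodule k := by
  induction a using Nat.strong_induction_on with
  | _ a ih =>
  intro d v hv hvs
  rcases eq_or_exists_odd_choose a with h | ⟨a', b, rfl, hα, hodd⟩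
  · have h' : 2 ^ alphaCount a - 1 = a := by omega
    rw [h']
    exact ⟨d, v, rfl, hv, hvs, by simp⟩
  obtain ⟨w, hw, hws, hwu⟩ := exists_conjugate_gradedSq (2 ^ b) d v hv hvs
  obtain ⟨d', v', hd', hv', hvs', hhit⟩ :=
    ih a' (Nat.lt_add_of_pos_right (by positivity)) _ w hw hws
  rw [hα] at hd' hhit
  refine ⟨d', v', by omega, hv', hvs', ?_⟩
  have h1 := hwu a' (X j ^ a') (isHomogeneous_X_pow j a')
  have hcast : ((a'.choose (2 ^ b) : ℕ) : MvPolynomial (Fin k) (ZMod 2)) = 1 := by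
    rw [← map_natCast (C : ZMod 2 →+* MvPolynomial (Fin k) (ZMod 2)),
      (ZMod.natCast_eq_one_iff_odd).2 hodd, map_one]
  rw [gradedSq_coeff_X_pow, hcast, one_mul] at h1
  convert add_mem h1 hhit using 1
  ring

/-- Lemma 3.7 (Nam): every monomial `x` of degree `n` in `P_k` is, modulo hit polynomials,
a sum of monomials `x̄` of degree `n` with `ν_1(x̄) = 2^t - 1`, where `t = α(ν_1(x))`. -/
theorem stmt17 (k n : ℕ) (hk : 0 < k) (a : Fin k →₀ ℕ) (ha : ∑ j, a j = n) :
    ∃ (q : ℕ) (y : Fin q → (Fin k →₀ ℕ)),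
      (∀ j, ∑ i : Fin k, y j i = n) ∧
      (∀ j, y j ⟨0, hk⟩ = 2 ^ alphaCount (a ⟨0, hk⟩) - 1) ∧
      IsHit k (MvPolynomial.monomial a (1 : ZMod 2) +
        ∑ j, MvPolynomial.monomial (y j) (1 : ZMod 2)) := by
  set o : Fin k := ⟨0, hk⟩
  have hsplit : monomial a (1 : ZMod 2) = X o ^ a o * monomial (a.erase o) 1 := by
    rw [X_pow_eq_monomial, monomial_mul, mul_one, Finsupp.single_add_erase]
  have hdeg : ∀ m : Fin k →₀ ℕ, m.degree = ∑ i, m i := fun m => m.degree_eq_sum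
  have hsum : (a.erase o).degree + a o = n := by
    rw [← ha, ← hdeg a]
    conv_rhs => rw [← Finsupp.single_add_erase o a, map_add, Finsupp.degree_single]
    exact add_comm _ _
  have hsupp : monomial (a.erase o) (1 : ZMod 2) ∈ supported (ZMod 2) {o}ᶜ := by
    rw [mem_supported, vars_monomial one_ne_zero]
    intro i hi
    simp only [Finsupp.support_erase, Finset.coe_erase] at hi
    exact hi.2
  obtain ⟨d, v, hd, hv, hvs, hhit⟩ := exists_X_pow_mul_sub_mem_hitSubmodule o (a o) _ _
    (isHomogeneous_monomial (1 : ZMod 2) (n := (a.erase o).degree) rfl) hsupp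
  let m : Fin v.support.card → (Fin k →₀ ℕ) := fun j => (v.support.equivFin.symm j : _)
  have hm : ∀ j, m j ∈ v.support := fun j => (v.support.equivFin.symm j).2
  have hmo : ∀ j, m j o = 0 := by
    intro j
    by_contra h
    rw [mem_supported] at hvs
    exact hvs (Finset.mem_coe.2 ((mem_vars_iff_mem_support o).2 ⟨m j, hm j, Finsupp.mem_support_iff.2 h⟩)) rfl
  refine ⟨v.support.card, fun j => Finsupp.single o (2 ^ alphaCount (a o) - 1) + m j, ?_, ?_, ?_⟩
  · intro j
    have hj : (m j).degree = d := by
      rw [Finsupp.degree_eq_weight_one]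
      exact hv (mem_support_iff.1 (hm j))
    rw [← hdeg, map_add, Finsupp.degree_single, hj]
    omega
  · intro j
    simp [hmo j]
  · have hv_sum : ∑ j, monomial (m j) (1 : ZMod 2) = v := by
      conv_rhs => rw [v.as_sum]
      rw [← Finset.sum_coe_sort v.support, ← v.support.equivFin.symm.sum_comp]
      refine Finset.sum_congr rfl fun j _ => ?_
      have h1 : coeff (m j) v = 1 := by
        have := mem_support_iff.1 (hm j)
        revert this
        generalize coeff (m j) v = r
        revert r
        decide
      exact congrArg (monomial (m j)) h1.symm
    have hy : ∑ j, monomial (Finsupp.single o (2 ^ alphaCount (a o) - 1) + m j) (1 : ZMod 2) =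
        X o ^ (2 ^ alphaCount (a o) - 1) * v := by
      refine Eq.trans ?_ (congrArg _ hv_sum)
      rw [Finset.mul_sum]
      refine Finset.sum_congr rfl fun j _ => ?_
      rw [X_pow_eq_monomial, monomial_mul, mul_one]
    rw [IsHit, hsplit, hy, ← CharTwo.sub_eq_add]
    exact hhit
end

section
/- Let k ≥ 3, let d_1 > d_2 > … > d_{k−2} ≥ d_{k−1} = d > 0 be integers, and set n = Σ_{i=1}^{k−1}(2^{d_i} − 1), m = Σ_{i=1}^{k−2}(2^{d_i − d} − 1), and p = min{k, d}. Then dim_{F_2}(QP_k)_n ≥ (Σ_{u=1}^{p} C(k,u)) · dim_{F_2}(QP_{k−1})_m, where C(k,u) denotes the binomial coefficient k choose u. -/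
open MvPolynomial

/-- The exponent vector `2b + (1, …, 1)`. -/
noncomputable def oddExponent {k : ℕ} (b : Fin k →₀ ℕ) : Fin k →₀ ℕ :=
  Finsupp.equivFunOnFinite.symm fun j => 2 * b j + 1

@[simp]
theorem oddExponent_apply {k : ℕ} (b : Fin k →₀ ℕ) (j : Fin k) :
    oddExponent b j = 2 * b j + 1 := rfl

theorem oddExponent_injective {k : ℕ} :
    Function.Injective (oddExponent : (Fin k →₀ ℕ) → (Fin k →₀ ℕ)) := by
  intro a b h
  ext j
  have := DFunLike.congr_fun h j
  simp only [oddExponent_apply] at this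
  omega

theorem degree_oddExponent {k : ℕ} (b : Fin k →₀ ℕ) :
    (oddExponent b).degree = 2 * b.degree + k := by
  simp [Finsupp.degree_eq_sum, Finset.sum_add_distrib, Finset.mul_sum]

/-- Kameko's down-squaring map: `x^(2b+1) ↦ x^b`, and every monomial with an even exponent
is sent to `0`. -/
noncomputable def kameko (k : ℕ) :
    MvPolynomial (Fin k) (ZMod 2) →ₗ[ZMod 2] MvPolynomial (Fin k) (ZMod 2) where
  toFun := AddMonoidAlgebra.comapDomain oddExponent oddExponent_injective
  map_add' := AddMonoidAlgebra.comapDomain_add _ _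
  map_smul' c f := by
    apply MvPolynomial.ext
    intro b
    rfl

@[simp]
theorem coeff_kameko {k : ℕ} (f : MvPolynomial (Fin k) (ZMod 2)) (b : Fin k →₀ ℕ) :
    coeff b (kameko k f) = coeff (oddExponent b) f := rfl

theorem kameko_mul_monomial_sq {k : ℕ} (f : MvPolynomial (Fin k) (ZMod 2)) (b : Fin k →₀ ℕ)
    (r : ZMod 2) : kameko k (f * monomial b r ^ 2) = kameko k f * monomial b r := by
  ext c
  have hr : r ^ 2 = r := ZMod.pow_card r
  have hle : 2 • b ≤ oddExponent c ↔ b ≤ c := by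
    simp only [Finsupp.le_def, Finsupp.smul_apply, smul_eq_mul, oddExponent_apply]
    exact forall_congr' fun j => by omega
  rw [monomial_pow, hr, coeff_kameko, coeff_mul_monomial', coeff_mul_monomial', coeff_kameko]
  simp only [hle]
  split_ifs with h
  · congr 2
    ext j
    have := h j
    simp only [Finsupp.tsub_apply, Finsupp.smul_apply, smul_eq_mul, oddExponent_apply]
    omega
  · rfl

theorem kameko_mul_sq {k : ℕ} (f h : MvPolynomial (Fin k) (ZMod 2)) :
    kameko k (f * h ^ 2) = kameko k f * h := by
  induction h using MvPolynomial.induction_on' with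
  | monomial b r => exact kameko_mul_monomial_sq f b r
  | add p q hp hq => rw [CharTwo.add_sq, mul_add, map_add, hp, hq, mul_add]

theorem prod_X_eq_monomial {k : ℕ} (T : Finset (Fin k)) :
    (∏ j ∈ T, X j : MvPolynomial (Fin k) (ZMod 2)) =
      monomial (Finsupp.equivFunOnFinite.symm fun j => if j ∈ T then 1 else 0) 1 := by
  rw [monomial_eq, Finsupp.prod_fintype _ _ (by simp)]
  simp [pow_ite, Finset.prod_ite_mem]

theorem kameko_prod_X {k : ℕ} (T : Finset (Fin k)) :
    kameko k (∏ j ∈ T, X j) = if T = Finset.univ then 1 else 0 := by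
  ext b
  rw [coeff_kameko, prod_X_eq_monomial, coeff_monomial]
  split_ifs with h h' h'
  · rw [coeff_one, if_pos]
    ext j
    have := DFunLike.congr_fun h j
    simp [h'] at this
    simp [this]
  · exfalso
    apply h'
    ext j
    have := DFunLike.congr_fun h j
    by_contra hj
    simp at hj
    simp [hj] at this
  · rw [coeff_one, if_neg]
    rintro rfl
    apply h
    ext j
    simp [h']
  · simp

theorem SqTotal_prod_X {k : ℕ} (S : Finset (Fin k)) :
    SqTotal k (∏ j ∈ S, X j) = ∑ T ∈ S.powerset, (∏ j ∈ T, X j) * (∏ j ∈ S \ T, X j) ^ 2 := by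
  simp only [SqTotal, map_prod, aeval_X, Finset.prod_add, Finset.prod_pow]

theorem kameko_SqTotal_prod_X {k : ℕ} (S : Finset (Fin k)) :
    kameko k (SqTotal k (∏ j ∈ S, X j)) = if S = Finset.univ then 1 else 0 := by
  simp only [SqTotal_prod_X, map_sum, kameko_mul_sq, kameko_prod_X]
  split_ifs with h
  · subst h
    simp
  · refine Finset.sum_eq_zero fun T hT => ?_
    rw [if_neg, zero_mul]
    rintro rfl
    exact h (Finset.univ_subset_iff.mp (Finset.mem_powerset.mp hT))

theorem monomial_eq_smul_prod_X_mul_sq {k : ℕ} (a : Fin k →₀ ℕ) (r : ZMod 2) :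
    ∃ (S : Finset (Fin k)) (h : MvPolynomial (Fin k) (ZMod 2)),
      monomial a r = r • ((∏ j ∈ S, X j) * h ^ 2) := by
  refine ⟨Finset.univ.filter fun j => a j % 2 = 1,
    monomial (Finsupp.equivFunOnFinite.symm fun j => a j / 2) 1, ?_⟩
  have ha : (Finsupp.equivFunOnFinite.symm fun j =>
      if j ∈ Finset.univ.filter (fun j => a j % 2 = 1) then 1 else 0) +
        2 • Finsupp.equivFunOnFinite.symm (fun j => a j / 2) = a := by
    ext j
    simp only [Finsupp.add_apply, Finsupp.smul_apply, Finsupp.equivFunOnFinite_symm_apply_apply,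
      Finset.mem_filter, Finset.mem_univ, true_and, smul_eq_mul]
    split_ifs <;> omega
  rw [prod_X_eq_monomial, monomial_pow, monomial_mul, ha]
  simp [smul_monomial]

theorem kameko_SqTotal {k : ℕ} (f : MvPolynomial (Fin k) (ZMod 2)) :
    kameko k (SqTotal k f) = SqTotal k (kameko k f) := by
  induction f using MvPolynomial.induction_on' with
  | monomial a r =>
    obtain ⟨S, h, e⟩ := monomial_eq_smul_prod_X_mul_sq a r
    rw [e, map_smul, map_smul, map_smul, map_smul, map_mul, map_pow, kameko_mul_sq,
      kameko_mul_sq, kameko_SqTotal_prod_X, kameko_prod_X, map_mul]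
    split_ifs <;> simp
  | add p q hp hq => simp only [map_add, hp, hq]

theorem isHomogeneous_kameko {k e : ℕ} {f : MvPolynomial (Fin k) (ZMod 2)}
    (hf : f.IsHomogeneous (2 * e + k)) : (kameko k f).IsHomogeneous e := by
  intro b hb
  rw [coeff_kameko] at hb
  by_contra h
  refine hb (hf.coeff_eq_zero ?_)
  rw [degree_oddExponent]
  have h' : b.degree ≠ e := by rwa [Finsupp.degree_eq_weight_one]
  omega

theorem kameko_eq_zero_of_isHomogeneous {k d : ℕ} {f : MvPolynomial (Fin k) (ZMod 2)}
    (hd : ∀ e, 2 * e + k ≠ d) (hf : f.IsHomogeneous d) : kameko k f = 0 := by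
  ext b
  rw [coeff_kameko, coeff_zero]
  exact hf.coeff_eq_zero (by rw [degree_oddExponent]; exact hd _)

theorem SqOp_of_isHomogeneous {k d : ℕ} (i : ℕ) {f : MvPolynomial (Fin k) (ZMod 2)}
    (hf : f.IsHomogeneous d) : SqOp k i f = homogeneousComponent (d + i) (SqTotal k f) := by
  by_cases h0 : f = 0
  · simp [h0, SqOp]
  · rw [SqOp, hf.totalDegree h0, Finset.sum_eq_single d]
    · rw [homogeneousComponent_eq_self hf]
    · intro b _ hb
      rw [homogeneousComponent_of_mem hf, if_neg hb]
      simp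
    · simp

/-- A linear map which commutes with the total square and rescales degrees monotonically
preserves hit polynomials. -/
theorem hitSubmodule_le_comap {k l : ℕ} (τ : ℕ → ℕ) (hτ : StrictMono τ)
    (Φ : MvPolynomial (Fin k) (ZMod 2) →ₗ[ZMod 2] MvPolynomial (Fin l) (ZMod 2))
    (hSq : ∀ f, Φ (SqTotal k f) = SqTotal l (Φ f))
    (hdeg : ∀ e f, f.IsHomogeneous (τ e) → (Φ f).IsHomogeneous e)
    (hzero : ∀ d f, (∀ e, τ e ≠ d) → f.IsHomogeneous d → Φ f = 0) :
    hitSubmodule k ≤ (hitSubmodule l).comap Φ := by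
  have hcomp : ∀ e f, Φ (homogeneousComponent (τ e) f) = homogeneousComponent e (Φ f) := by
    intro e f
    have hterm : ∀ d, homogeneousComponent e (Φ (homogeneousComponent d f)) =
        if d = τ e then Φ (homogeneousComponent d f) else 0 := by
      intro d
      by_cases h : ∃ e', τ e' = d
      · obtain ⟨e', rfl⟩ := h
        rw [homogeneousComponent_of_mem
          (hdeg _ _ (homogeneousComponent_isHomogeneous (τ e') f))]
        simp only [hτ.injective.eq_iff, eq_comm]
      · push Not at h
        rw [hzero d _ h (homogeneousComponent_isHomogeneous _ _), map_zero, ite_self]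
    calc Φ (homogeneousComponent (τ e) f)
        = ∑ d ∈ Finset.range (f.totalDegree + 1),
            homogeneousComponent e (Φ (homogeneousComponent d f)) := by
          simp only [hterm, Finset.sum_ite_eq']
          split_ifs with he
          · rfl
          · rw [homogeneousComponent_eq_zero _ _ (by simpa using he), map_zero]
      _ = homogeneousComponent e (Φ f) := by
          rw [← map_sum, ← map_sum, sum_homogeneousComponent]
  rw [hitSubmodule, Submodule.span_le]
  rintro _ ⟨i, f, hi, rfl⟩
  simp only [SqOp, Submodule.comap_coe, Set.mem_preimage, SetLike.mem_coe, map_sum]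
  refine Submodule.sum_mem _ fun d _ => ?_
  by_cases h : ∃ e, τ e = d + i
  · obtain ⟨e, he⟩ := h
    rw [← he, hcomp, hSq]
    by_cases h' : ∃ e', τ e' = d
    · obtain ⟨e', rfl⟩ := h'
      have hlt : e' < e := hτ.lt_iff_lt.mp (by omega)
      refine Submodule.subset_span ⟨e - e', homogeneousComponent e' (Φ f), by omega, ?_⟩
      rw [SqOp_of_isHomogeneous _ (homogeneousComponent_isHomogeneous _ _), hcomp,
        Nat.add_sub_cancel' hlt.le]
    · push Not at h'
      rw [hzero d _ h' (homogeneousComponent_isHomogeneous _ _)]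
      simp
  · push Not at h
    rw [hzero _ _ h (homogeneousComponent_isHomogeneous _ _)]
    exact Submodule.zero_mem _

theorem kameko_mem_hitSubmodule {k : ℕ} {f : MvPolynomial (Fin k) (ZMod 2)}
    (hf : f ∈ hitSubmodule k) : kameko k f ∈ hitSubmodule k :=
  hitSubmodule_le_comap (fun e => 2 * e + k) (fun _ _ h => by dsimp only; omega) (kameko k)
    kameko_SqTotal (fun _ _ => isHomogeneous_kameko)
    (fun _ _ => kameko_eq_zero_of_isHomogeneous) hf

theorem kameko_X_mul_prod_compl {k : ℕ} (s t : Fin k) :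
    kameko k (X s * ∏ j ∈ {t}ᶜ, X j) = if s = t then 1 else 0 := by
  split_ifs with h
  · subst h
    rw [← Finset.prod_singleton (fun j => (X j : MvPolynomial (Fin k) (ZMod 2))) s,
      Finset.prod_mul_prod_compl, kameko_prod_X, if_pos rfl]
  · have hs : s ∈ ({t}ᶜ : Finset (Fin k)) := by simpa using h
    have : (X s * ∏ j ∈ {t}ᶜ, X j : MvPolynomial (Fin k) (ZMod 2)) =
        (∏ j ∈ ({t}ᶜ : Finset (Fin k)).erase s, X j) * X s ^ 2 := by
      rw [← Finset.mul_prod_erase _ _ hs]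
      ring
    rw [this, kameko_mul_sq, kameko_prod_X, if_neg, zero_mul]
    intro h'
    exact Finset.notMem_erase s _ (h' ▸ Finset.mem_univ s)

/-- Restriction to the hyperplane `∑_{s ∈ B} x_s = 0` (for `i ∈ B`), with the coordinates
other than `x_i` as variables. -/
noncomputable def hyperplaneRestrict {k : ℕ} (i : Fin (k + 1)) (B : Finset (Fin (k + 1))) :
    MvPolynomial (Fin (k + 1)) (ZMod 2) →ₐ[ZMod 2] MvPolynomial (Fin k) (ZMod 2) :=
  aeval (i.insertNth (α := fun _ => MvPolynomial (Fin k) (ZMod 2))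
    (∑ s with i.succAbove s ∈ B, X s) X)

@[simp]
theorem hyperplaneRestrict_X_same {k : ℕ} (i : Fin (k + 1)) (B : Finset (Fin (k + 1))) :
    hyperplaneRestrict i B (X i) = ∑ s with i.succAbove s ∈ B, X s := by
  simp [hyperplaneRestrict]

@[simp]
theorem hyperplaneRestrict_X_succAbove {k : ℕ} (i : Fin (k + 1)) (B : Finset (Fin (k + 1)))
    (s : Fin k) : hyperplaneRestrict i B (X (i.succAbove s)) = X s := by
  simp [hyperplaneRestrict]

theorem hyperplaneRestrict_rename {k : ℕ} (i : Fin (k + 1)) (B : Finset (Fin (k + 1)))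
    (f : MvPolynomial (Fin k) (ZMod 2)) :
    hyperplaneRestrict i B (rename i.succAbove f) = f := by
  have : (hyperplaneRestrict i B).comp (rename i.succAbove) = AlgHom.id (ZMod 2) _ :=
    algHom_ext fun s => by simp
  exact DFunLike.congr_fun this f

theorem hyperplaneRestrict_SqTotal {k : ℕ} (i : Fin (k + 1)) (B : Finset (Fin (k + 1)))
    (f : MvPolynomial (Fin (k + 1)) (ZMod 2)) :
    hyperplaneRestrict i B (SqTotal (k + 1) f) = SqTotal k (hyperplaneRestrict i B f) := by
  have : (hyperplaneRestrict i B).comp (SqTotal (k + 1)) =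
      (SqTotal k).comp (hyperplaneRestrict i B) := by
    refine algHom_ext fun j => ?_
    cases j using i.succAboveCases with
    | x => simp [SqTotal, Finset.sum_add_distrib, CharTwo.sum_sq]
    | p s => simp [SqTotal]
  exact DFunLike.congr_fun this f

theorem isHomogeneous_hyperplaneRestrict {k e : ℕ} (i : Fin (k + 1)) (B : Finset (Fin (k + 1)))
    {f : MvPolynomial (Fin (k + 1)) (ZMod 2)} (hf : f.IsHomogeneous e) :
    (hyperplaneRestrict i B f).IsHomogeneous e := by
  rw [← one_mul e]
  refine hf.aeval _ fun j => ?_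
  cases j using i.succAboveCases with
  | x => simpa using IsHomogeneous.sum _ _ _ fun s _ => isHomogeneous_X _ s
  | p s => simpa using isHomogeneous_X _ s

theorem hyperplaneRestrict_mem_hitSubmodule {k : ℕ} (i : Fin (k + 1))
    (B : Finset (Fin (k + 1))) {f : MvPolynomial (Fin (k + 1)) (ZMod 2)}
    (hf : f ∈ hitSubmodule (k + 1)) : hyperplaneRestrict i B f ∈ hitSubmodule k :=
  hitSubmodule_le_comap id strictMono_id (hyperplaneRestrict i B).toLinearMap
    (hyperplaneRestrict_SqTotal i B) (fun _ _ => isHomogeneous_hyperplaneRestrict i B)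
    (fun d _ h => absurd rfl (h d)) hf

theorem kameko_hyperplaneRestrict_prod_compl {k : ℕ} {i : Fin (k + 1)}
    {B : Finset (Fin (k + 1))} (hi : i ∈ B) (s : Fin (k + 1)) :
    kameko k (hyperplaneRestrict i B (∏ j ∈ {s}ᶜ, X j)) = if s ∈ B then 1 else 0 := by
  have hprod : (∏ j ∈ {s}ᶜ, X j : MvPolynomial (Fin (k + 1)) (ZMod 2)) =
      ∏ j, if j = s then 1 else X j := by
    rw [Finset.prod_ite, Finset.prod_const_one, one_mul]
    congr 1
    ext j
    simp
  rw [hprod, map_prod, Fin.prod_univ_succAbove _ i]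
  cases s using i.succAboveCases with
  | x => simp [hi, Fin.succAbove_ne, kameko_prod_X]
  | p t =>
    have ht : (∏ j : Fin k, hyperplaneRestrict i B
        (if i.succAbove j = i.succAbove t then 1 else X (i.succAbove j))) =
          ∏ j ∈ {t}ᶜ, X j := by
      rw [← Finset.prod_mul_prod_compl {t}]
      simp only [Finset.prod_singleton, if_true, map_one, one_mul]
      refine Finset.prod_congr rfl fun j hj => ?_
      have hj' : j ≠ t := by simpa using hj
      simp [hj']
    rw [ht, if_neg (Fin.succAbove_ne i t).symm, hyperplaneRestrict_X_same, Finset.sum_mul,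
      map_sum]
    simp [kameko_X_mul_prod_compl, Finset.sum_ite_eq']

theorem kameko_pow_mem_hitSubmodule {k : ℕ} (d : ℕ) {f : MvPolynomial (Fin k) (ZMod 2)}
    (hf : f ∈ hitSubmodule k) : (kameko k ^ d) f ∈ hitSubmodule k := by
  induction d generalizing f with
  | zero => simpa using hf
  | succ d ih =>
    rw [pow_succ, Module.End.mul_apply]
    exact ih (kameko_mem_hitSubmodule hf)

theorem isHomogeneous_kameko_pow {k : ℕ} (d : ℕ) {m : ℕ} {f : MvPolynomial (Fin k) (ZMod 2)}
    (hf : f.IsHomogeneous (2 ^ d * m + k * (2 ^ d - 1))) :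
    ((kameko k ^ d) f).IsHomogeneous m := by
  induction d generalizing f with
  | zero => simpa using hf
  | succ d ih =>
    rw [pow_succ, Module.End.mul_apply]
    refine ih (isHomogeneous_kameko ?_)
    convert hf using 1
    obtain ⟨c, hc⟩ : ∃ c, 2 ^ d = c + 1 :=
      Nat.exists_eq_add_one.mpr (Nat.two_pow_pos d)
    have h2 : 2 ^ (d + 1) - 1 = 2 * c + 1 := by rw [pow_succ, hc]; omega
    rw [h2, pow_succ, hc, Nat.add_sub_cancel]
    ring

theorem kameko_pow_prod_mul {k : ℕ} (d : ℕ) (u : ℕ → MvPolynomial (Fin k) (ZMod 2))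
    (c : ℕ → ZMod 2) (hu : ∀ t, kameko k (u t) = C (c t)) (g : MvPolynomial (Fin k) (ZMod 2)) :
    (kameko k ^ d) ((∏ t ∈ Finset.range d, u t ^ 2 ^ t) * g ^ 2 ^ d) =
      (∏ t ∈ Finset.range d, c t) • g := by
  induction d generalizing u c with
  | zero => simp
  | succ d ih =>
    have : (∏ t ∈ Finset.range (d + 1), u t ^ 2 ^ t) * g ^ 2 ^ (d + 1) =
        u 0 * ((∏ t ∈ Finset.range d, u (t + 1) ^ 2 ^ t) * g ^ 2 ^ d) ^ 2 := by
      rw [Finset.prod_range_succ']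
      simp only [mul_pow, ← Finset.prod_pow, ← pow_mul, ← pow_succ, pow_zero, pow_one]
      ring
    rw [this, pow_succ, Module.End.mul_apply, kameko_mul_sq, hu, ← smul_eq_C_mul, map_smul,
      ih _ _ fun t => hu (t + 1), Finset.prod_range_succ', smul_smul, mul_comm]

/-- The polynomial `∏_{t < d} (∏_{j ≠ g t} x_j)^(2^t)`. -/
noncomputable def spikeQuotient {k : ℕ} (d : ℕ) (g : ℕ → Fin k) :
    MvPolynomial (Fin k) (ZMod 2) :=
  ∏ t ∈ Finset.range d, (∏ j ∈ {g t}ᶜ, X j) ^ 2 ^ t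

theorem isHomogeneous_spikeQuotient {k : ℕ} (d : ℕ) (g : ℕ → Fin (k + 1)) :
    (spikeQuotient d g).IsHomogeneous (k * (2 ^ d - 1)) := by
  have hsum : ∑ t ∈ Finset.range d, k * 2 ^ t = k * (2 ^ d - 1) := by
    rw [← Finset.mul_sum, Nat.geomSum_eq le_rfl]
    simp
  rw [← hsum]
  refine IsHomogeneous.prod _ _ _ fun t _ => IsHomogeneous.pow ?_ _
  have := IsHomogeneous.prod ({g t}ᶜ : Finset (Fin (k + 1)))
    (X : Fin (k + 1) → MvPolynomial (Fin (k + 1)) (ZMod 2)) (fun _ => 1)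
    fun j _ => isHomogeneous_X _ j
  simpa [Finset.card_compl] using this

theorem kameko_pow_hyperplaneRestrict_spikeQuotient_mul {k : ℕ} {i : Fin (k + 1)}
    {B : Finset (Fin (k + 1))} (hi : i ∈ B) (d : ℕ) (g : ℕ → Fin (k + 1))
    (f : MvPolynomial (Fin (k + 1)) (ZMod 2)) :
    (kameko k ^ d) (hyperplaneRestrict i B (spikeQuotient d g * f ^ 2 ^ d)) =
      if ∀ t < d, g t ∈ B then hyperplaneRestrict i B f else 0 := by
  simp only [spikeQuotient, map_mul, map_pow, map_prod]
  rw [kameko_pow_prod_mul d _ (fun t => if g t ∈ B then 1 else 0)]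
  · rw [Finset.prod_ite_zero]
    simp [ite_smul]
  · intro t
    rw [← map_prod, kameko_hyperplaneRestrict_prod_compl hi]
    split_ifs <;> simp

theorem exists_forall_mem_iff_subset {k d : ℕ} {A : Finset (Fin k)} (hA : A.Nonempty)
    (hd : A.card ≤ d) : ∃ g : ℕ → Fin k, ∀ B : Finset (Fin k),
      (∀ t < d, g t ∈ B) ↔ A ⊆ B := by
  obtain ⟨a, ha⟩ := hA
  refine ⟨fun t => if h : t < A.card then A.orderEmbOfFin rfl ⟨t, h⟩ else a, fun B => ?_⟩
  constructor
  · intro h b hb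
    have hb' : b ∈ Set.range (A.orderEmbOfFin rfl) := by simpa using hb
    obtain ⟨⟨t, ht⟩, rfl⟩ := hb'
    simpa [ht] using h t (ht.trans_le hd)
  · intro h t _
    dsimp only
    split_ifs
    · exact h (A.orderEmbOfFin_mem rfl _)
    · exact h ha

theorem card_nonempty_card_le (k d : ℕ) :
    Fintype.card {A : Finset (Fin k) // A.Nonempty ∧ A.card ≤ d} =
      ∑ u ∈ Finset.Icc 1 (min k d), k.choose u := by
  classical
  rw [Fintype.card_subtype, Finset.card_eq_sum_card_fiberwise (f := Finset.card)
    (t := Finset.Icc 1 (min k d))]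
  · refine Finset.sum_congr rfl fun u hu => ?_
    rw [Finset.mem_Icc, le_min_iff] at hu
    have := Finset.card_powersetCard u (Finset.univ : Finset (Fin k))
    rw [Finset.card_univ, Fintype.card_fin] at this
    rw [← this]
    congr 1
    ext A
    simp only [Finset.mem_filter, Finset.mem_univ, true_and, Finset.mem_powersetCard,
      Finset.subset_univ, ← Finset.card_pos]
    omega
  · intro A hA
    have hA' : A.Nonempty ∧ A.card ≤ d := by simpa using hA
    have := Finset.card_le_univ A
    rw [Fintype.card_fin] at this
    simp only [Finset.coe_Icc, Set.mem_Icc, le_min_iff]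
    exact ⟨Finset.card_pos.mpr hA'.1, this, hA'.2⟩

/-- The map `(QP_{k+1})_n → (QP_k)_m`, for `n = 2^d m + k (2^d - 1)`, induced by restriction to
a hyperplane followed by the `d`-fold Kameko map. -/
noncomputable def restrictKameko {k : ℕ} (d m : ℕ) (i : Fin (k + 1)) (B : Finset (Fin (k + 1))) :
    QP (k + 1) (2 ^ d * m + k * (2 ^ d - 1)) →ₗ[ZMod 2] QP k m :=
  Submodule.mapQ _ _
    (((kameko k ^ d) ∘ₗ (hyperplaneRestrict i B).toLinearMap).restrict fun _ hf =>
      isHomogeneous_kameko_pow d (isHomogeneous_hyperplaneRestrict i B hf))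
    fun _ hf => kameko_pow_mem_hitSubmodule d (hyperplaneRestrict_mem_hitSubmodule i B hf)

instance (k n : ℕ) : FiniteDimensional (ZMod 2) (QP k n) :=
  have : FiniteDimensional (ZMod 2) (homogeneousSubmodule (Fin k) (ZMod 2) n) :=
    Module.Finite.iff_fg.mpr (homogeneousSubmodule_fg _ _ n)
  inferInstance

theorem exists_restrictKameko_eq {k d m : ℕ} {A : Finset (Fin (k + 1))} (hA : A.Nonempty)
    (hd : A.card ≤ d) {a : Fin (k + 1)} (ha : a ∈ A) (y : QP k m) :
    ∃ z : QP (k + 1) (2 ^ d * m + k * (2 ^ d - 1)),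
      restrictKameko d m a A z = y ∧
        ∀ B, ∀ i ∈ B, ¬A ⊆ B → restrictKameko d m i B z = 0 := by
  obtain ⟨⟨f, hf⟩, rfl⟩ := Submodule.mkQ_surjective _ y
  obtain ⟨g, hg⟩ := exists_forall_mem_iff_subset hA hd
  have hz : (spikeQuotient d g * rename a.succAbove f ^ 2 ^ d).IsHomogeneous
      (2 ^ d * m + k * (2 ^ d - 1)) := by
    rw [add_comm (2 ^ d * m), mul_comm (2 ^ d) m]
    exact (isHomogeneous_spikeQuotient d g).mul
      (IsHomogeneous.pow (IsHomogeneous.rename_isHomogeneous hf) _)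
  refine ⟨Submodule.mkQ _ ⟨_, hz⟩, ?_, fun B i hi hB => ?_⟩
  · change Submodule.mkQ _ _ = _
    congr 1
    apply Subtype.ext
    refine (kameko_pow_hyperplaneRestrict_spikeQuotient_mul ha d g _).trans ?_
    rw [if_pos ((hg A).mpr subset_rfl),
      hyperplaneRestrict_rename]
  · change Submodule.mkQ _ _ = _
    refine (congrArg _ ?_).trans (map_zero _)
    apply Subtype.ext
    refine (kameko_pow_hyperplaneRestrict_spikeQuotient_mul hi d g _).trans ?_
    rw [if_neg (mt (hg B).mp hB)]
    rfl

/-- A linear map into a finite product indexed by a partial order is surjective as soon as it is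
triangular with surjective diagonal. -/
theorem surjective_pi_of_triangular {R ι M : Type*} {N : ι → Type*} [Ring R] [Finite ι]
    [PartialOrder ι] [AddCommGroup M] [Module R M] [∀ i, AddCommGroup (N i)]
    [∀ i, Module R (N i)] (φ : ∀ i, M →ₗ[R] N i)
    (h : ∀ i (y : N i), ∃ z, φ i z = y ∧ ∀ j, ¬i ≤ j → φ j z = 0) :
    Function.Surjective (LinearMap.pi φ) := by
  classical
  have := Fintype.ofFinite ι
  rw [← LinearMap.range_eq_top, eq_top_iff, ← LinearMap.iSup_range_single, iSup_le_iff]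
  intro i
  induction i using WellFoundedGT.induction with
  | ind i ih =>
    rintro _ ⟨y, rfl⟩
    obtain ⟨z, hz, hz'⟩ := h i y
    have hsum : LinearMap.single R N i y =
        LinearMap.pi φ z - ∑ j with i < j, LinearMap.single R N j (φ j z) := by
      rw [eq_sub_iff_add_eq]
      ext j
      simp only [Pi.add_apply, Finset.sum_apply, LinearMap.coe_single, LinearMap.pi_apply,
        Finset.sum_pi_single, Finset.mem_filter, Finset.mem_univ, true_and]
      rcases eq_or_ne i j with rfl | hij
      · simp [hz]
      · rw [Pi.single_eq_of_ne hij.symm, zero_add]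
        split_ifs with hlt
        · rfl
        · exact (hz' j fun hle => hlt (lt_of_le_of_ne hle hij)).symm
    rw [hsum]
    refine Submodule.sub_mem _ ⟨z, rfl⟩ (Submodule.sum_mem _ fun j hj => ?_)
    exact ih j (Finset.mem_filter.mp hj).2 ⟨_, rfl⟩

theorem sum_choose_mul_finrank_QP_le (k d m : ℕ) :
    (∑ u ∈ Finset.Icc 1 (min (k + 1) d), (k + 1).choose u) * Module.finrank (ZMod 2) (QP k m) ≤
      Module.finrank (ZMod 2) (QP (k + 1) (2 ^ d * m + k * (2 ^ d - 1))) := by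
  classical
  let ι := {A : Finset (Fin (k + 1)) // A.Nonempty ∧ A.card ≤ d}
  let φ (A : ι) : QP (k + 1) (2 ^ d * m + k * (2 ^ d - 1)) →ₗ[ZMod 2] QP k m :=
    restrictKameko d m A.2.1.choose A.1
  have hφ : Function.Surjective (LinearMap.pi φ) := by
    refine surjective_pi_of_triangular (R := ZMod 2) (N := fun _ => QP k m) φ fun A y => ?_
    obtain ⟨z, hz, hz'⟩ := exists_restrictKameko_eq A.2.1 A.2.2 A.2.1.choose_spec y
    exact ⟨z, hz, fun B hB => hz' B.1 _ B.2.1.choose_spec hB⟩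
  have := LinearMap.finrank_le_finrank_of_surjective hφ
  rwa [Module.finrank_pi_fintype, Finset.sum_const, Finset.card_univ, card_nonempty_card_le,
    smul_eq_mul] at this

theorem sum_two_pow_sub_one (s : Finset ℕ) (d : ℕ → ℕ) (c : ℕ) (hc : ∀ i ∈ s, c ≤ d i) :
    ∑ i ∈ s, (2 ^ d i - 1) = 2 ^ c * ∑ i ∈ s, (2 ^ (d i - c) - 1) + s.card * (2 ^ c - 1) := by
  rw [Finset.mul_sum, ← smul_eq_mul s.card, ← Finset.sum_const, ← Finset.sum_add_distrib]
  refine Finset.sum_congr rfl fun i hi => ?_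
  have h1 : 2 ^ d i = 2 ^ c * 2 ^ (d i - c) := by rw [← pow_add, Nat.add_sub_cancel' (hc i hi)]
  have h2 : 1 ≤ 2 ^ c := Nat.one_le_two_pow
  have h3 : 2 ^ c * 1 ≤ 2 ^ c * 2 ^ (d i - c) := Nat.mul_le_mul_left _ Nat.one_le_two_pow
  rw [Nat.mul_sub, ← h1]
  omega

/-- Corollary (Mothebe): for `k ≥ 3`, integers `d_1 > … > d_{k-2} ≥ d_{k-1} = d > 0`,
`n = Σ_{i=1}^{k-1} (2^{d_i} - 1)`, `m = Σ_{i=1}^{k-2} (2^{d_i - d} - 1)` and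
`p = min{k, d}`, one has
`dim (QP_k)_n ≥ (Σ_{u=1}^{p} C(k,u)) · dim (QP_{k-1})_m`. -/
theorem stmt18 (k : ℕ) (hk : 3 ≤ k) (d : ℕ → ℕ)
    (hpos : ∀ i, 1 ≤ i → i ≤ k - 1 → 0 < d i)
    (hstrict : ∀ i, 2 ≤ i → i ≤ k - 2 → d i < d (i - 1))
    (hweak : d (k - 1) ≤ d (k - 2)) :
    (∑ u ∈ Finset.Icc 1 (min k (d (k - 1))), Nat.choose k u) *
        Module.finrank (ZMod 2)
          (QP (k - 1) (∑ i ∈ Finset.Icc 1 (k - 2), (2 ^ (d i - d (k - 1)) - 1))) ≤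
      Module.finrank (ZMod 2) (QP k (∑ i ∈ Finset.Icc 1 (k - 1), (2 ^ d i - 1))) := by
  obtain ⟨l, rfl⟩ : ∃ l, k = l + 1 + 1 := ⟨k - 2, by omega⟩
  simp only [Nat.add_sub_cancel, show l + 1 + 1 - 2 = l by omega] at *
  have hle : ∀ i ≤ l, 1 ≤ i → d (l + 1) ≤ d i := by
    intro i hi
    induction hi using Nat.decreasingInduction with
    | self => exact fun _ => hweak
    | of_succ i hi ih =>
      intro h1
      have := hstrict (i + 1) (by omega) (by omega)
      exact (ih (by omega)).trans this.le
  have hn := sum_two_pow_sub_one (Finset.Icc 1 (l + 1)) d (d (l + 1)) fun i hi => by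
    obtain ⟨h1, h2⟩ := Finset.mem_Icc.mp hi
    rcases h2.lt_or_eq with h | rfl
    · exact hle i (by omega) h1
    · exact le_rfl
  rw [Finset.sum_Icc_succ_top (f := fun i => 2 ^ (d i - d (l + 1)) - 1) (by omega), Nat.sub_self,
    pow_zero, Nat.sub_self, add_zero, Nat.card_Icc, Nat.add_sub_cancel] at hn
  have key := sum_choose_mul_finrank_QP_le (l + 1) (d (l + 1))
    (∑ i ∈ Finset.Icc 1 l, (2 ^ (d i - d (l + 1)) - 1))
  rw [← hn] at key
  exact key
end
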